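/- arXiv:2506.06312 — 4 statements merged into one kernel-verified Lean document; each statement's English description precedes it below -/
import Mathlib

section
/- Let a be a real number with |a| > 1, and for each integer n ≥ 0 set a_n = (2/a) · ∑_{k=0}^{∞} (2a)^(-n-2k) · C(n+2k,k) (this series converges absolutely). Then for every real number t, the series a_0/2 + ∑_{n=1}^{∞} a_n · cos(n·t) converges and its sum equals 1/(a − cos t). -/
theorem cos_pow_aux (t : ℝ) (m : ℕ) :
    ∑ p ∈ Finset.HasAntidiagonal.antidiagonal m, ((p.1 + p.2).choose p.2 : ℝ) * Real.cos (((p.1 : ℝ) - p.2) * t)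
      = (2 * Real.cos t) ^ m := by
  have h1 : ((2 * Real.cos t : ℝ) : ℂ) = Complex.exp (t * Complex.I) + Complex.exp (-t * Complex.I) := by
    push_cast
    rw [Complex.two_cos]
  have h2 : (((2 * Real.cos t) ^ m : ℝ) : ℂ) =
      ∑ p ∈ Finset.HasAntidiagonal.antidiagonal m, ((p.1 + p.2).choose p.2 : ℂ) *
        Complex.exp (((((p.1 : ℝ) - p.2) * t : ℝ) : ℂ) * Complex.I) := by
    rw [Complex.ofReal_pow, h1, (Commute.all _ _).add_pow']
    refine Finset.sum_congr rfl fun p hp => ?_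
    rw [← Finset.HasAntidiagonal.mem_antidiagonal.mp hp, Nat.choose_symm_add, nsmul_eq_mul, ← Complex.exp_nat_mul,
      ← Complex.exp_nat_mul, ← Complex.exp_add]
    congr 2
    push_cast
    ring
  have h3 := congrArg Complex.re h2
  rw [Complex.ofReal_re, Complex.re_sum] at h3
  rw [h3]
  refine Finset.sum_congr rfl fun p _ => ?_
  rw [← Complex.ofReal_natCast, Complex.re_ofReal_mul, Complex.exp_ofReal_mul_I_re]

def splitEquiv : (ℕ × ℕ) ⊕ (ℕ × ℕ) ≃ ℕ × ℕ where
  toFun := Sum.elim (fun p => (p.1 + p.2, p.2)) (fun p => (p.2, p.1 + 1 + p.2))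
  invFun p := if p.2 ≤ p.1 then Sum.inl (p.1 - p.2, p.2) else Sum.inr (p.2 - p.1 - 1, p.1)
  left_inv := by
    rintro (⟨n, k⟩ | ⟨n, k⟩)
    · simp
    · have : ¬ (n + 1 + k ≤ k) := by omega
      simp only [Sum.elim_inr, this, if_false, Sum.inr.injEq, Prod.mk.injEq, and_true]
      omega
  right_inv := by
    rintro ⟨p, q⟩
    by_cases h : q ≤ p
    · simp [h]
    · simp only [h, if_false, Sum.elim_inr, Prod.mk.injEq, true_and]
      omega

theorem summable_aux (y : ℝ) (hy : |2 * y| < 1) :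
    Summable fun p : ℕ × ℕ => y ^ (p.1 + p.2) * ((p.1 + p.2).choose p.2 : ℝ) := by
  rw [← Finset.HasAntidiagonal.sigmaAntidiagonalEquivProd.summable_iff]
  refine Summable.of_norm ?_
  refine (summable_sigma_of_nonneg fun _ => norm_nonneg _).2 ⟨fun m => (hasSum_fintype _).summable, ?_⟩
  have hg : Summable fun m : ℕ => |2 * y| ^ m := summable_geometric_of_lt_one (abs_nonneg _) hy
  refine hg.congr fun m => ?_
  rw [tsum_fintype]
  have : ∑ p ∈ Finset.HasAntidiagonal.antidiagonal m, ‖y ^ (p.1 + p.2) * ((p.1 + p.2).choose p.2 : ℝ)‖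
      = |2 * y| ^ m := by
    have h := cos_pow_aux 0 m
    simp only [mul_zero, Real.cos_zero, mul_one] at h
    rw [abs_mul, mul_pow, abs_two, ← h, Finset.sum_mul]
    refine Finset.sum_congr rfl fun p hp => ?_
    rw [← Finset.HasAntidiagonal.mem_antidiagonal.mp hp, norm_mul, norm_pow, Real.norm_natCast, Real.norm_eq_abs,
      mul_comm]
  rw [← this, ← Finset.sum_coe_sort]
  rfl

theorem stmt_16 (a : ℝ) (ha : 1 < |a|) (A : ℕ → ℝ)
    (hA : ∀ n : ℕ, A n = (2 / a) *
      ∑' k : ℕ, (2 * a) ^ (-(n : ℤ) - 2 * (k : ℤ)) * ((n + 2 * k).choose k : ℝ)) (t : ℝ) :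
    (∀ n : ℕ,
        Summable fun k : ℕ => |(2 * a) ^ (-(n : ℤ) - 2 * (k : ℤ)) * ((n + 2 * k).choose k : ℝ)|) ∧
      HasSum (fun n : ℕ => A (n + 1) * Real.cos ((n + 1 : ℕ) * t))
        (1 / (a - Real.cos t) - A 0 / 2) := by
  have ha0 : a ≠ 0 := by
    rintro rfl
    simp at ha
    linarith
  obtain ⟨y, hy⟩ : ∃ y : ℝ, y = (2 * a)⁻¹ := ⟨_, rfl⟩
  have h2y : 2 * y = a⁻¹ := by rw [hy]; field_simp
  have hy1 : |2 * y| < 1 := by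
    rw [h2y, abs_inv]
    exact inv_lt_one_of_one_lt₀ ha
  have hG := summable_aux y hy1
  have hterm : ∀ n k : ℕ, (2 * a) ^ (-(n : ℤ) - 2 * (k : ℤ)) * ((n + 2 * k).choose k : ℝ)
      = y ^ (n + k + k) * ((n + k + k).choose k : ℝ) := by
    intro n k
    have e : (-(n : ℤ) - 2 * (k : ℤ)) = -((n + k + k : ℕ) : ℤ) := by push_cast; ring
    rw [e, zpow_neg, zpow_natCast, hy, inv_pow, two_mul k, ← add_assoc]
  simp only [hterm] at hA ⊢
  have hfib : ∀ n : ℕ, Summable fun k : ℕ => y ^ (n + k + k) * ((n + k + k).choose k : ℝ) := by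
    intro n
    refine hG.comp_injective (i := fun k : ℕ => (n + k, k)) ?_
    intro k l h
    exact (Prod.mk.inj h).2
  refine ⟨fun n => (hfib n).abs, ?_⟩
  obtain ⟨F, hF⟩ : ∃ F : ℕ × ℕ → ℝ, F = fun p => a⁻¹ * (y ^ (p.1 + p.2) *
    ((p.1 + p.2).choose p.2 : ℝ) * Real.cos (((p.1 : ℝ) - p.2) * t)) := ⟨_, rfl⟩
  have hFs : Summable F := by
    rw [hF]
    refine Summable.mul_left _ ?_
    refine Summable.of_norm_bounded hG.norm fun p => ?_
    rw [norm_mul]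
    exact mul_le_of_le_one_right (norm_nonneg _) (Real.abs_cos_le_one _)
  -- the total sum along antidiagonals
  have hc : |a⁻¹ * Real.cos t| < 1 := by
    rw [abs_mul, ← h2y]
    exact lt_of_le_of_lt (mul_le_of_le_one_right (abs_nonneg _) (Real.abs_cos_le_one _)) hy1
  have hac : a - Real.cos t ≠ 0 := by
    intro h
    have : |a| ≤ 1 := by
      rw [sub_eq_zero.mp h]; exact Real.abs_cos_le_one _
    linarith
  have hFtot : HasSum F (1 / (a - Real.cos t)) := by
    have h1 := (Finset.HasAntidiagonal.sigmaAntidiagonalEquivProd (A := ℕ)).hasSum_iff.2 hFs.hasSum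
    have h2 : HasSum (fun m : ℕ => a⁻¹ * (a⁻¹ * Real.cos t) ^ m) (∑' p, F p) := by
      refine h1.sigma fun m => ?_
      have : ∑ p ∈ Finset.HasAntidiagonal.antidiagonal m, F p = a⁻¹ * (a⁻¹ * Real.cos t) ^ m := by
        rw [← h2y, show 2 * y * Real.cos t = y * (2 * Real.cos t) by ring, mul_pow,
          ← cos_pow_aux, Finset.mul_sum, Finset.mul_sum, hF, h2y]
        refine Finset.sum_congr rfl fun p hp => ?_
        rw [← Finset.HasAntidiagonal.mem_antidiagonal.mp hp]
        ring
      rw [← this, ← Finset.sum_coe_sort]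
      exact hasSum_fintype _
    have h3 := (hasSum_geometric_of_abs_lt_one hc).mul_left a⁻¹
    have h4 : a⁻¹ * (1 - a⁻¹ * Real.cos t)⁻¹ = 1 / (a - Real.cos t) := by
      rw [← mul_inv, one_div]
      congr 1
      field_simp
    rw [← h4, ← h2.unique h3]
    exact hFs.hasSum
  have hE : Summable (F ∘ splitEquiv) := splitEquiv.summable_iff.2 hFs
  have hEt := splitEquiv.hasSum_iff.2 hFtot
  have hl : Summable (fun p : ℕ × ℕ => F (p.1 + p.2, p.2)) := hE.comp_injective Sum.inl_injective
  have hr : Summable (fun p : ℕ × ℕ => F (p.2, p.1 + 1 + p.2)) :=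
    hE.comp_injective Sum.inr_injective
  have hsum := (HasSum.sum (f := F ∘ splitEquiv) hl.hasSum hr.hasSum).unique hEt
  have hL : HasSum (fun n : ℕ => A n / 2 * Real.cos (n * t)) (∑' p : ℕ × ℕ, F (p.1 + p.2, p.2)) := by
    refine hl.hasSum.prod_fiberwise fun n => ?_
    have := ((hfib n).hasSum.mul_left a⁻¹).mul_right (Real.cos (n * t))
    convert! this using 1
    · funext k
      simp only [hF]
      push_cast
      rw [add_sub_cancel_right]
      ring
    · rw [hA]; ring
  have hR : HasSum (fun n : ℕ => A (n + 1) / 2 * Real.cos ((n + 1 : ℕ) * t))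
      (∑' p : ℕ × ℕ, F (p.2, p.1 + 1 + p.2)) := by
    refine hr.hasSum.prod_fiberwise fun n => ?_
    have := ((hfib (n + 1)).hasSum.mul_left a⁻¹).mul_right (Real.cos ((n + 1 : ℕ) * t))
    convert! this using 1
    · funext k
      simp only [hF]
      rw [← Real.cos_neg, add_comm k (n + 1 + k), Nat.choose_symm_add]
      push_cast
      rw [show -(((k : ℝ) - (n + 1 + k)) * t) = (n + 1) * t by ring]
      ring
    · rw [hA]; ring
  have hL' := (hasSum_nat_add_iff' 1).2 hL
  have := hL'.add hR
  convert! this using 1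
  · funext n
    ring
  · rw [← hsum]
    simp
    ring
end

section
/- Let a be a real number with |a| > 1, and for each integer n ≥ 0 set a_n = (2/a) · ∑_{k=0}^{∞} (2a)^(-n-2k) · C(n+2k,k) (this series converges absolutely). Then for every integer n ≥ 1, one has (a_{n-1} − a·a_n)·a_0 = 2·a_n. -/
def sTerm (x : ℝ) (n k : ℕ) : ℝ := x ^ (n + 2 * k) * ((n + 2 * k).choose k : ℝ)

lemma sTerm_bound (x : ℝ) (n k : ℕ) : ‖sTerm x n k‖ ≤ |2 * x| ^ n * (|2 * x| ^ 2) ^ k := by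
  have h : ((n + 2 * k).choose k : ℝ) ≤ 2 ^ (n + 2 * k) := by
    exact_mod_cast Nat.choose_le_two_pow _ _
  rw [sTerm, norm_mul, norm_pow, Real.norm_eq_abs, Real.norm_eq_abs, Nat.abs_cast,
    ← pow_mul, ← pow_add, abs_mul, mul_pow, abs_two, mul_comm]
  gcongr

lemma sq_lt {x : ℝ} (hx : |2 * x| < 1) : |2 * x| ^ 2 < 1 := by
  have := abs_nonneg (2 * x)
  nlinarith

lemma sTerm_summable {x : ℝ} (hx : |2 * x| < 1) (n : ℕ) : Summable (sTerm x n) := by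
  refine Summable.of_norm_bounded ?_ (sTerm_bound x n)
  exact (summable_geometric_of_lt_one (by positivity) (sq_lt hx)).mul_left _

lemma sTerm_tsum_bound {x : ℝ} (hx : |2 * x| < 1) (n : ℕ) :
    |∑' k, sTerm x n k| ≤ (1 - |2 * x| ^ 2)⁻¹ := by
  have h := (hasSum_geometric_of_lt_one (by positivity) (sq_lt hx)).mul_left (|2 * x| ^ n)
  have h1 := tsum_of_norm_bounded h (sTerm_bound x n)
  rw [Real.norm_eq_abs] at h1
  refine h1.trans ?_
  have := sq_lt hx
  have h2 : 0 ≤ (1 - |2 * x| ^ 2)⁻¹ := inv_nonneg.2 (by linarith)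
  exact mul_le_of_le_one_left h2 (pow_le_one₀ (abs_nonneg _) hx.le)

lemma s_rec {x : ℝ} (hx : |2 * x| < 1) (n : ℕ) :
    ∑' k, sTerm x (n + 1) k = x * (∑' k, sTerm x n k + ∑' k, sTerm x (n + 2) k) := by
  rw [(sTerm_summable hx (n + 1)).tsum_eq_zero_add, (sTerm_summable hx n).tsum_eq_zero_add,
    add_assoc, ← Summable.tsum_add ((summable_nat_add_iff 1).2 (sTerm_summable hx n))
      (sTerm_summable hx (n + 2)), mul_add, ← tsum_mul_left]
  congr 1
  · simp [sTerm, pow_succ, mul_comm]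
  · congr 1
    ext k
    simp only [sTerm]
    rw [show n + 1 + 2 * (k + 1) = (n + 2 + 2 * k) + 1 by ring,
      show n + 2 * (k + 1) = n + 2 + 2 * k by ring, Nat.choose_succ_succ]
    push_cast
    ring

lemma s_zero {x : ℝ} (hx : |2 * x| < 1) :
    ∑' k, sTerm x 0 k = 1 + 2 * x * ∑' k, sTerm x 1 k := by
  rw [(sTerm_summable hx 0).tsum_eq_zero_add, ← tsum_mul_left]
  congr 1
  · simp [sTerm]
  · congr 1
    ext k
    simp only [sTerm]
    rw [show 0 + 2 * (k + 1) = (1 + 2 * k) + 1 by ring, Nat.choose_succ_succ,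
      Nat.choose_symm_of_eq_add (show 1 + 2 * k = k.succ + k by omega)]
    push_cast
    ring

lemma key {x : ℝ} (hx0 : x ≠ 0) (hx : |2 * x| < 1) (S : ℕ → ℝ) (B : ℝ)
    (hB : ∀ n, |S n| ≤ B) (hr : ∀ n, S (n + 1) = x * (S n + S (n + 2)))
    (h0 : S 0 = 1 + 2 * x * S 1) (n : ℕ) :
    (2 * x * S n - S (n + 1)) * S 0 = S (n + 1) := by
  have h4 : 0 < 1 - 4 * x ^ 2 := by
    have := sq_lt hx
    rw [sq_abs] at this
    nlinarith
  obtain ⟨s, hs, hs2⟩ : ∃ s : ℝ, 0 < s ∧ s ^ 2 = 1 - 4 * x ^ 2 :=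
    ⟨_, Real.sqrt_pos.2 h4, Real.sq_sqrt h4.le⟩
  obtain ⟨r, hrs⟩ : ∃ r : ℝ, r * (1 + s) = 2 * x := ⟨2 * x / (1 + s), by field_simp⟩
  have hxr : 2 * x * r = 1 - s := by
    have : (2 * x * r - (1 - s)) * (1 + s) = 0 := by linear_combination 2 * x * hrs + hs2
    rcases mul_eq_zero.1 this with h | h <;> linarith
  have hq : x * r ^ 2 = r - x := by linear_combination (r * hxr - hrs) / 2
  have hr1 : |r| < 1 := by
    have : |r| * (1 + s) < 1 := by
      rw [← abs_of_pos (show 0 < 1 + s by linarith), ← abs_mul, hrs]; exact hx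
    nlinarith [abs_nonneg r]
  have hD : ∀ m, S (m + 1) - r * S m = r * (S (m + 2) - r * S (m + 1)) := by
    intro m
    apply mul_left_cancel₀ hx0
    linear_combination r * hr m + S (m + 1) * hq
  have hDm : ∀ m j, S (m + 1) - r * S m = r ^ j * (S (m + j + 1) - r * S (m + j)) := by
    intro m j
    induction j with
    | zero => simp
    | succ j ih => rw [ih, hD (m + j)]; ring_nf
  have hz : ∀ m, S (m + 1) = r * S m := by
    intro m
    have hb : ∀ j, |S (m + 1) - r * S m| ≤ |r| ^ j * (2 * B) := by
      intro j
      rw [hDm m j, abs_mul, abs_pow]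
      gcongr
      have h1 := hB (m + j + 1)
      have h2 := hB (m + j)
      have h3 := abs_sub (S (m + j + 1)) (r * S (m + j))
      rw [abs_mul] at h3
      nlinarith [abs_nonneg (S (m + j))]
    have ht := (tendsto_pow_atTop_nhds_zero_of_lt_one (abs_nonneg r) hr1).mul_const (2 * B)
    rw [zero_mul] at ht
    have := abs_nonpos_iff.1 (ge_of_tendsto' ht hb)
    linarith
  have hs0 : s * S 0 = 1 := by
    rw [hz 0] at h0
    linear_combination h0 + S 0 * hxr
  rw [hz n]
  linear_combination r * S n * hs0 - S n * S 0 * hrs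

theorem stmt_17 (a : ℝ) (ha : 1 < |a|) (A : ℕ → ℝ)
    (hA : ∀ n : ℕ, A n = (2 / a) *
      ∑' k : ℕ, (2 * a) ^ (-(n : ℤ) - 2 * (k : ℤ)) * ((n + 2 * k).choose k : ℝ))
    (n : ℕ) (hn : 1 ≤ n) :
    (A (n - 1) - a * A n) * A 0 = 2 * A n := by
  have ha0 : a ≠ 0 := by rintro rfl; norm_num at ha
  obtain ⟨m, rfl⟩ : ∃ m, n = m + 1 := ⟨n - 1, by omega⟩
  have hx0 : (2 * a)⁻¹ ≠ 0 := by positivity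
  have hx : |2 * (2 * a)⁻¹| < 1 := by
    rw [show 2 * (2 * a)⁻¹ = a⁻¹ by field_simp, abs_inv]
    exact inv_lt_one_of_one_lt₀ ha
  have hS : ∀ n, A n = (2 / a) * ∑' k, sTerm (2 * a)⁻¹ n k := by
    intro n
    rw [hA]
    congr 2
    ext k
    rw [sTerm, inv_pow, ← zpow_natCast, ← zpow_neg]
    congr 2
    push_cast
    ring
  have hk := key hx0 hx (fun n => ∑' k, sTerm (2 * a)⁻¹ n k) _ (sTerm_tsum_bound hx)
    (s_rec hx) (s_zero hx) m
  simp only [Nat.add_sub_cancel, hS]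
  generalize ∑' k, sTerm (2 * a)⁻¹ m k = u at *
  generalize ∑' k, sTerm (2 * a)⁻¹ (m + 1) k = v at *
  generalize ∑' k, sTerm (2 * a)⁻¹ 0 k = w at *
  field_simp at hk ⊢
  linear_combination hk
end

section
/- Let a be a real number with |a| > 1. Then for every real number t, the series (1/(a·√(1 − a^(-2)))) + ∑_{n=1}^{∞} ( 2·a^(n-1)·(1 − √(1 − a^(-2)))^n / √(1 − a^(-2)) ) · cos(n·t) converges and its sum equals 1/(a − cos t). -/
lemma aux_geom (r t : ℝ) (hr : r ^ 2 < 1) :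
    HasSum (fun n : ℕ => r ^ (n + 1) * Real.cos ((n + 1 : ℕ) * t))
      ((r * Real.cos t - r ^ 2) / (1 - 2 * r * Real.cos t + r ^ 2)) := by
  have hr1 : |r| < 1 := by
    rwa [← sq_lt_one_iff_abs_lt_one]
  set z : ℂ := r * Complex.exp (t * Complex.I) with hz
  have hn : ‖z‖ < 1 := by
    rw [hz, norm_mul, Complex.norm_exp_ofReal_mul_I, mul_one, Complex.norm_real]
    exact hr1
  have h := Complex.hasSum_re ((hasSum_geometric_of_norm_lt_one hn).mul_left z)
  have hre : z.re = r * Real.cos t := by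
    rw [hz, Complex.re_ofReal_mul, Complex.exp_ofReal_mul_I_re]
  have him : z.im = r * Real.sin t := by
    rw [hz, Complex.im_ofReal_mul, Complex.exp_ofReal_mul_I_im]
  have hsc := Real.sin_sq_add_cos_sq t
  convert h using 1
  · funext n
    have : z * z ^ n = ((r ^ (n + 1) : ℝ) : ℂ) *
        Complex.exp ((((n + 1 : ℕ) * t : ℝ) : ℂ) * Complex.I) := by
      rw [← pow_succ', hz, mul_pow, ← Complex.exp_nat_mul]
      push_cast
      ring_nf
    rw [this, Complex.re_ofReal_mul, Complex.exp_ofReal_mul_I_re]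
  · have hN : Complex.normSq (1 - z) = 1 - 2 * r * Real.cos t + r ^ 2 := by
      rw [Complex.normSq_apply]
      simp only [Complex.sub_re, Complex.sub_im, Complex.one_re, Complex.one_im, hre, him]
      linear_combination r ^ 2 * hsc
    rw [Complex.mul_re, Complex.inv_re, Complex.inv_im, hN]
    simp only [Complex.sub_re, Complex.sub_im, Complex.one_re, Complex.one_im, hre, him]
    rw [← mul_div_assoc, ← mul_div_assoc, ← sub_div]
    congr 1
    linear_combination r ^ 2 * hsc

theorem stmt_18 (a : ℝ) (ha : 1 < |a|) (t : ℝ) :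
    HasSum
      (fun n : ℕ =>
        2 * a ^ n * (1 - Real.sqrt (1 - a ^ (-2 : ℤ))) ^ (n + 1) /
            Real.sqrt (1 - a ^ (-2 : ℤ)) * Real.cos ((n + 1 : ℕ) * t))
      (1 / (a - Real.cos t) - 1 / (a * Real.sqrt (1 - a ^ (-2 : ℤ)))) := by
  have ha2 : 1 < a ^ 2 := by
    rwa [one_lt_sq_iff_one_lt_abs]
  have ha0 : a ≠ 0 := by
    rintro rfl
    norm_num at ha2
  have hz : a ^ (-2 : ℤ) = (a ^ 2)⁻¹ := by
    rw [zpow_neg]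
    norm_cast
  rw [hz]
  have hi1 : (a ^ 2)⁻¹ < 1 := inv_lt_one_of_one_lt₀ ha2
  have hi0 : 0 < (a ^ 2)⁻¹ := by positivity
  have hs0 : 0 < Real.sqrt (1 - (a ^ 2)⁻¹) := Real.sqrt_pos.2 (by linarith)
  have hs2 : Real.sqrt (1 - (a ^ 2)⁻¹) ^ 2 = 1 - (a ^ 2)⁻¹ := Real.sq_sqrt (by linarith)
  set s := Real.sqrt (1 - (a ^ 2)⁻¹) with hs
  have hs1 : s < 1 := by nlinarith
  have hk : a ^ 2 * (1 - s ^ 2) = 1 := by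
    rw [hs2]
    field_simp
    ring
  have hq : (a * (1 - s)) ^ 2 = 2 * a * (a * (1 - s)) - 1 := by
    linear_combination -hk
  have hr : (a * (1 - s)) ^ 2 < 1 := by
    have : 0 < a ^ 2 * (1 - s) * s := by
      have : 0 < 1 - s := by linarith
      positivity
    nlinarith
  have hac : a - Real.cos t ≠ 0 := by
    intro h
    have h1 : a = Real.cos t := by linarith
    have := Real.abs_cos_le_one t
    rw [← h1] at this
    linarith
  have h1s : 1 - s ≠ 0 := by linarith
  have hD : 1 - 2 * (a * (1 - s)) * Real.cos t + (a * (1 - s)) ^ 2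
      = 2 * (a * (1 - s)) * (a - Real.cos t) := by
    linear_combination hq
  have h := (aux_geom (a * (1 - s)) t hr).mul_left (2 / (a * s))
  have hsne := hs0.ne'
  clear_value s
  convert h using 1
  · rfl
  · funext n
    rw [mul_pow, pow_succ a]
    field_simp
  · rw [hD]
    field_simp
    ring
end

section
/- Let a be a real number with |a| > 1. Then for every real number t, one has 1/(a − sin t) = 1/(a·√(1 − a^(-2))) + ∑_{k=1}^{∞} (-1)^k · ( 2·a^(2k-1)·(1 − √(1 − a^(-2)))^(2k) / √(1 − a^(-2)) ) · cos(2k·t) + ∑_{k=0}^{∞} (-1)^k · ( 2·a^(2k)·(1 − √(1 − a^(-2)))^(2k+1) / √(1 − a^(-2)) ) · sin((2k+1)·t), both series on the right-hand side being convergent. -/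
lemma re_aux (c : ℝ) (x : ℝ) (n : ℕ) :
    ((c : ℂ) * Complex.exp ((x : ℂ) * Complex.I) ^ n).re = c * Real.cos (n * x) ∧
    ((c : ℂ) * (-Complex.I) * Complex.exp ((x : ℂ) * Complex.I) ^ n).re
      = c * Real.sin (n * x) := by
  have h : Complex.exp ((x : ℂ) * Complex.I) ^ n
      = Complex.exp (((n * x : ℝ) : ℂ) * Complex.I) := by
    rw [← Complex.exp_nat_mul]; push_cast; ring_nf
  rw [h]
  constructor
  · rw [Complex.re_ofReal_mul, Complex.exp_ofReal_mul_I_re]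
  · rw [mul_assoc, Complex.re_ofReal_mul]
    congr 1
    rw [← Complex.exp_ofReal_mul_I_im, Complex.mul_re, Complex.neg_re, Complex.neg_im,
      Complex.I_re, Complex.I_im]
    ring

lemma sums_aux (r t : ℝ) (hr : r ^ 2 < 1) : ∃ A B : ℝ,
    HasSum (fun k : ℕ => (-1 : ℝ) ^ (k + 1) * r ^ (2 * (k + 1)) *
      Real.cos ((2 * (k + 1) : ℕ) * t)) A ∧
    HasSum (fun k : ℕ => (-1 : ℝ) ^ k * r ^ (2 * k + 1) * Real.sin ((2 * k + 1 : ℕ) * t)) B ∧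
    (1 + 2 * A + 2 * B) * (1 - 2 * r * Real.sin t + r ^ 2) = 1 - r ^ 2 := by
  set z := Complex.exp ((t : ℂ) * Complex.I) with hz
  set ξ : ℂ := (-Complex.I) * r * z with hξ
  have hI : Complex.I ^ 2 = -1 := Complex.I_sq
  have hn : ‖ξ‖ < 1 := by
    have : ‖ξ‖ = |r| := by
      simp [hξ, hz, Complex.norm_exp_ofReal_mul_I]
    rw [this]; exact (sq_lt_one_iff_abs_lt_one r).1 hr
  have hn2 : ‖ξ ^ 2‖ < 1 := by
    rw [norm_pow]; exact pow_lt_one₀ (norm_nonneg _) hn two_ne_zero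
  have hw : ξ ^ 2 = (-1) * (r : ℂ) ^ 2 * z ^ 2 := by
    rw [hξ]; linear_combination (r : ℂ) ^ 2 * z ^ 2 * hI
  have g := hasSum_geometric_of_norm_lt_one hn2
  have gA := Complex.hasSum_re (g.mul_left (ξ ^ 2))
  have gB := Complex.hasSum_re (g.mul_left ξ)
  refine ⟨(ξ ^ 2 * (1 - ξ ^ 2)⁻¹).re, (ξ * (1 - ξ ^ 2)⁻¹).re, ?_, ?_, ?_⟩
  · convert gA using 2 with k
    rw [← (re_aux _ t _).1]
    congr 1
    rw [hw, ← hz]; push_cast; ring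
  · convert gB using 2 with k
    rw [← (re_aux _ t _).2]
    congr 1
    rw [hw, ← hz, hξ]; push_cast; ring
  · have h1 : 1 - ξ ≠ 0 := by
      intro h
      have : ξ = 1 := (sub_eq_zero.1 h).symm
      rw [this] at hn; simp at hn
    have h2 : 1 - ξ ^ 2 ≠ 0 := by
      intro h
      have : ξ ^ 2 = 1 := (sub_eq_zero.1 h).symm
      rw [this] at hn2; simp at hn2
    have e : ξ ^ 2 * (1 - ξ ^ 2)⁻¹ + ξ * (1 - ξ ^ 2)⁻¹ = ξ / (1 - ξ) := by
      field_simp; ring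
    have e' := congrArg Complex.re e
    rw [Complex.add_re] at e'
    have xr : ξ.re = r * Real.sin t := by
      simp [hξ, hz, Complex.exp_ofReal_mul_I_im, Complex.exp_ofReal_mul_I_re]
    have xi : ξ.im = - (r * Real.cos t) := by
      simp [hξ, hz, Complex.exp_ofReal_mul_I_im, Complex.exp_ofReal_mul_I_re]
    have ns : Complex.normSq (1 - ξ) = 1 - 2 * r * Real.sin t + r ^ 2 := by
      rw [Complex.normSq_apply]; simp only [Complex.sub_re, Complex.sub_im, xr, xi, Complex.one_re, Complex.one_im]
      linear_combination r ^ 2 * Real.sin_sq_add_cos_sq t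
    have nz : Complex.normSq (1 - ξ) ≠ 0 := by simpa using h1
    rw [Complex.div_re] at e'
    have e2 : ξ.re * (1 - ξ).re / Complex.normSq (1 - ξ) + ξ.im * (1 - ξ).im / Complex.normSq (1 - ξ)
      = (r * Real.sin t - r ^ 2) / Complex.normSq (1 - ξ) := by
      rw [← add_div]; congr 1
      simp only [Complex.sub_re, Complex.sub_im, xr, xi, Complex.one_re, Complex.one_im]
      linear_combination -r ^ 2 * Real.sin_sq_add_cos_sq t
    rw [e2, eq_div_iff nz, ns] at e'
    linear_combination 2 * e'

theorem stmt_19 (a : ℝ) (ha : 1 < |a|) (t : ℝ) :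
    Summable (fun k : ℕ => (-1 : ℝ) ^ (k + 1) *
        (2 * a ^ (2 * (k + 1) - 1) * (1 - Real.sqrt (1 - a ^ (-2 : ℤ))) ^ (2 * (k + 1)) /
          Real.sqrt (1 - a ^ (-2 : ℤ))) * Real.cos ((2 * (k + 1) : ℕ) * t)) ∧
    Summable (fun k : ℕ => (-1 : ℝ) ^ k *
        (2 * a ^ (2 * k) * (1 - Real.sqrt (1 - a ^ (-2 : ℤ))) ^ (2 * k + 1) /
          Real.sqrt (1 - a ^ (-2 : ℤ))) * Real.sin ((2 * k + 1 : ℕ) * t)) ∧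
    1 / (a - Real.sin t) =
      1 / (a * Real.sqrt (1 - a ^ (-2 : ℤ))) +
        (∑' k : ℕ, (-1 : ℝ) ^ (k + 1) *
          (2 * a ^ (2 * (k + 1) - 1) * (1 - Real.sqrt (1 - a ^ (-2 : ℤ))) ^ (2 * (k + 1)) /
            Real.sqrt (1 - a ^ (-2 : ℤ))) * Real.cos ((2 * (k + 1) : ℕ) * t)) +
        (∑' k : ℕ, (-1 : ℝ) ^ k *
          (2 * a ^ (2 * k) * (1 - Real.sqrt (1 - a ^ (-2 : ℤ))) ^ (2 * k + 1) /
            Real.sqrt (1 - a ^ (-2 : ℤ))) * Real.sin ((2 * k + 1 : ℕ) * t)) := by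
  have ha2 : 1 < a ^ 2 := (one_lt_sq_iff_one_lt_abs a).2 ha
  have ha0 : a ≠ 0 := by rintro rfl; norm_num at ha2
  have hinv : a ^ (-2 : ℤ) = (a ^ 2)⁻¹ := by rw [zpow_neg]; norm_cast
  have hpos : 0 < 1 - a ^ (-2 : ℤ) := by
    rw [hinv, sub_pos]; exact inv_lt_one_of_one_lt₀ ha2
  have hs0 := Real.sqrt_pos.2 hpos
  have hsq := Real.sq_sqrt hpos.le
  rw [hinv] at hsq hs0 ⊢
  set s := Real.sqrt (1 - (a ^ 2)⁻¹) with hs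
  have key : a ^ 2 * (1 - s) * (1 + s) = 1 := by
    have : a ^ 2 * (a ^ 2)⁻¹ = 1 := mul_inv_cancel₀ (by positivity)
    linear_combination (-a ^ 2) * hsq + this
  have h1s : 0 < 1 - s := by
    by_contra h
    nlinarith [mul_nonneg (mul_nonneg (sq_nonneg a) (by linarith : 0 ≤ s - 1)) (by linarith : 0 ≤ 1 + s)]
  have hr : (a * (1 - s)) ^ 2 < 1 := by
    have : 0 < a ^ 2 * (1 - s) := by positivity
    nlinarith [mul_pos this hs0]
  obtain ⟨A, B, hA, hB, hAB⟩ := sums_aux (a * (1 - s)) t hr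
  have hA' := hA.mul_left (2 / (a * s))
  have hB' := hB.mul_left (2 / (a * s))
  have fA : (fun k : ℕ => (-1 : ℝ) ^ (k + 1) * (2 * a ^ (2 * (k + 1) - 1) *
      (1 - s) ^ (2 * (k + 1)) / s) * Real.cos ((2 * (k + 1) : ℕ) * t)) =
      fun k : ℕ => 2 / (a * s) * ((-1 : ℝ) ^ (k + 1) * (a * (1 - s)) ^ (2 * (k + 1)) *
      Real.cos ((2 * (k + 1) : ℕ) * t)) := by
    funext k
    have h : 2 * (k + 1) - 1 = 2 * k + 1 := by omega
    have h' : a ^ (2 * (k + 1)) = a ^ (2 * k + 1) * a := by ring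
    rw [h, mul_pow a, h']
    generalize Real.cos _ = c
    field_simp
  have fB : (fun k : ℕ => (-1 : ℝ) ^ k * (2 * a ^ (2 * k) *
      (1 - s) ^ (2 * k + 1) / s) * Real.sin ((2 * k + 1 : ℕ) * t)) =
      fun k : ℕ => 2 / (a * s) * ((-1 : ℝ) ^ k * (a * (1 - s)) ^ (2 * k + 1) *
      Real.sin ((2 * k + 1 : ℕ) * t)) := by
    funext k
    rw [mul_pow a, pow_succ a]
    generalize Real.sin _ = c
    field_simp
  rw [fA, fB]
  refine ⟨hA'.summable, hB'.summable, ?_⟩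
  rw [hA'.tsum_eq, hB'.tsum_eq]
  have hd : a - Real.sin t ≠ 0 := by
    intro h
    have : a = Real.sin t := by linarith
    rw [this] at ha
    exact absurd (Real.abs_sin_le_one t) (not_le.2 ha)
  have hs' : s ≠ 0 := hs0.ne'
  have hT : (1 + 2 * A + 2 * B) * (a - Real.sin t) = a * s := by
    have h0 : 2 * (a * (1 - s)) ≠ 0 := by
      have := h1s.ne'
      positivity
    apply mul_left_cancel₀ h0
    linear_combination hAB + (2 * A + 2 * B) * key
  have : 1 / (a * s) + 2 / (a * s) * A + 2 / (a * s) * B = (1 + 2 * A + 2 * B) / (a * s) := by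
    ring
  rw [this, div_eq_div_iff hd (mul_ne_zero ha0 hs')]
  linear_combination -hT
end
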